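/- Let f belong to the class S and let z ∈ 𝔻 with |z| = r < 1. Then (1−r)/(1+r)³ ≤ |f'(z)| ≤ (1+r)/(1−r)³. -/

import Mathlib

open Metric
open ComplexConjugate Topology MeasureTheory Filter

/-- The real-linear map `w ↦ a w + c (conj w)` of the complex plane. -/
noncomputable def addConjMap (a c : ℂ) : ℂ →ₗ[ℝ] ℂ :=
  LinearMap.mulLeft ℝ a + LinearMap.mulLeft ℝ c ∘ₗ Complex.conjAe.toLinearMap

@[simp]
theorem addConjMap_apply (a c w : ℂ) : addConjMap a c w = a * w + c * conj w := by
  simp [addConjMap]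

theorem det_addConjMap (a c : ℂ) : LinearMap.det (addConjMap a c) = ‖a‖ ^ 2 - ‖c‖ ^ 2 := by
  rw [← LinearMap.det_toMatrix Complex.basisOneI, Matrix.det_fin_two, ← Complex.normSq_eq_norm_sq,
    ← Complex.normSq_eq_norm_sq, Complex.normSq_apply, Complex.normSq_apply]
  simp [LinearMap.toMatrix_apply]
  ring

theorem volume_setOf_norm_sub_mul_conj_le {c : ℂ} (hc : ‖c‖ < 1) {R : ℝ} (hR : 0 ≤ R) :
    volume {w : ℂ | ‖w - c * conj w‖ ≤ R} = ENNReal.ofReal (Real.pi * R ^ 2 / (1 - ‖c‖ ^ 2)) := by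
  have hpos : 0 < 1 - ‖c‖ ^ 2 := by nlinarith [norm_nonneg c]
  have hdet : LinearMap.det (addConjMap 1 (-c)) = 1 - ‖c‖ ^ 2 := by simp [det_addConjMap]
  have hset : {w : ℂ | ‖w - c * conj w‖ ≤ R} = addConjMap 1 (-c) ⁻¹' closedBall 0 R := by
    ext w
    simp [sub_eq_add_neg]
  rw [hset, Measure.addHaar_preimage_linearMap _ (by rw [hdet]; exact hpos.ne'), hdet,
    Complex.volume_closedBall, abs_of_pos (inv_pos.2 hpos), ← ENNReal.ofReal_pow hR,
    ← ENNReal.ofReal_coe_nnreal, ← ENNReal.ofReal_mul (by positivity),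
    ← ENNReal.ofReal_mul (by positivity)]
  congr 1
  simp only [NNReal.coe_real_pi]
  field_simp

theorem isPreconnected_setOf_lt_norm_sub_mul_conj {c : ℂ} (hc : ‖c‖ < 1) {R : ℝ} (hR : 0 ≤ R) :
    IsPreconnected {w : ℂ | R < ‖w - c * conj w‖} := by
  have hpos : 0 < 1 - ‖c‖ ^ 2 := by nlinarith [norm_nonneg c]
  have hcc : (1 : ℂ) - c * conj c ≠ 0 := by
    rw [Complex.mul_conj, Complex.normSq_eq_norm_sq]
    exact_mod_cast hpos.ne'
  have hcc' : (1 : ℂ) - conj c * c ≠ 0 := by rwa [mul_comm]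
  let F : ℝ × ℝ → ℂ := fun p ↦
    (p.1 * Complex.exp (p.2 * Complex.I) + c * conj (p.1 * Complex.exp (p.2 * Complex.I))) /
      (1 - c * conj c)
  have hF : Continuous F := by
    refine Continuous.div_const (Continuous.add (by fun_prop) (continuous_const.mul ?_)) _
    exact Complex.continuous_conj.comp (by fun_prop)
  have himage : {w : ℂ | R < ‖w - c * conj w‖} = F '' (Set.Ioi R ×ˢ Set.univ) := by
    ext w
    simp only [Set.mem_ofPred_eq, Set.mem_image, Set.mem_prod, Set.mem_Ioi, Set.mem_univ, and_true,
      Prod.exists, F]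
    constructor
    · intro hw
      refine ⟨‖w - c * conj w‖, (w - c * conj w).arg, hw, ?_⟩
      rw [Complex.norm_mul_exp_arg_mul_I]
      simp only [map_sub, map_mul, Complex.conj_conj]
      field_simp
      ring
    · rintro ⟨r, θ, hr, rfl⟩
      have : ‖(r : ℂ) * Complex.exp (θ * Complex.I)‖ = r := by
        rw [norm_mul, Complex.norm_exp_ofReal_mul_I, mul_one, Complex.norm_real,
          Real.norm_of_nonneg (hR.trans hr.le)]
      generalize (r : ℂ) * Complex.exp (θ * Complex.I) = v at this
      have hv : (v + c * conj v) / (1 - c * conj c) -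
          c * conj ((v + c * conj v) / (1 - c * conj c)) = v := by
        simp only [map_sub, map_mul, map_add, map_div₀, map_one, Complex.conj_conj]
        field_simp
        ring
      rw [hv, this]
      exact hr
  rw [himage]
  exact ((convex_Ioi R).isPreconnected.prod isPreconnected_univ).image F hF.continuousOn

theorem subset_image_punctured_ball {g : ℂ → ℂ} {ρ : ℝ}
    (hg : ContinuousOn g (closedBall 0 ρ \ {0})) (hopen : IsOpen (g '' (ball 0 ρ \ {0})))
    (hlim : Tendsto (fun z ↦ ‖g z‖) (𝓝[≠] 0) atTop) {Ω : Set ℂ} (hΩ : IsPreconnected Ω)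
    (hne : (Ω ∩ g '' (ball 0 ρ \ {0})).Nonempty) (hsph : ∀ z ∈ sphere (0 : ℂ) ρ, g z ∉ Ω) :
    Ω ⊆ g '' (ball 0 ρ \ {0}) := by
  refine hΩ.subset_of_closure_inter_subset hopen hne ?_
  rintro w ⟨hw, hwΩ⟩
  obtain ⟨δ, hδ, hfar⟩ := Metric.mem_nhdsWithin_iff.1 (hlim.eventually_gt_atTop (‖w‖ + 1))
  have hsub : closedBall (0 : ℂ) ρ \ ball 0 δ ⊆ closedBall 0 ρ \ {0} := by
    rintro z ⟨hz, hzδ⟩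
    refine ⟨hz, ?_⟩
    rintro rfl
    exact hzδ (mem_ball_self hδ)
  have hcomp : IsCompact (g '' (closedBall 0 ρ \ ball 0 δ)) :=
    ((isCompact_closedBall 0 ρ).diff isOpen_ball).image_of_continuousOn (hg.mono hsub)
  have hmem : w ∈ g '' (closedBall 0 ρ \ ball 0 δ) := by
    rw [← hcomp.isClosed.closure_eq]
    rw [Metric.mem_closure_iff] at hw ⊢
    intro ε hε
    obtain ⟨_, ⟨z, ⟨hz, hz0⟩, rfl⟩, hdist⟩ := hw (min ε 1) (lt_min hε one_pos)
    refine ⟨_, ⟨z, ⟨ball_subset_closedBall hz, fun hzδ ↦ ?_⟩, rfl⟩,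
      hdist.trans_le (min_le_left _ _)⟩
    have h1 : ‖w‖ + 1 < ‖g z‖ := hfar ⟨hzδ, hz0⟩
    have h2 : ‖g z - w‖ < 1 := by
      rw [← dist_eq_norm, dist_comm]; exact hdist.trans_le (min_le_right _ _)
    linarith [norm_le_norm_add_norm_sub' (g z) w]
  obtain ⟨z, hz, rfl⟩ := hmem
  refine ⟨z, ⟨?_, (hsub hz).2⟩, rfl⟩
  rw [mem_ball_zero_iff]
  refine lt_of_le_of_ne (mem_closedBall_zero_iff.1 hz.1) fun h ↦ ?_
  exact hsph z (mem_sphere_zero_iff_norm.2 h) hwΩ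

theorem integral_circleMap_eq_zero {V : ℂ → ℂ} (hV : DifferentiableOn ℂ V (ball 0 1))
    (hV0 : V 0 = 0) {r : ℝ} (hr0 : 0 < r) (hr1 : r < 1) :
    ∫ θ in (-Real.pi)..Real.pi, V (circleMap 0 r θ) = 0 := by
  have hdiff : DiffContOnCl ℂ V (ball 0 |r|) := by
    refine (hV.mono ?_).diffContOnCl
    rw [abs_of_pos hr0, closure_ball _ hr0.ne']
    exact closedBall_subset_ball hr1
  have havg := hdiff.circleAverage
  rw [hV0, Real.circleAverage_def, smul_eq_zero] at havg
  have hper : Function.Periodic (fun θ ↦ V (circleMap 0 r θ)) (2 * Real.pi) := fun θ ↦ by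
    simp [periodic_circleMap 0 r θ]
  have hshift := hper.intervalIntegral_add_eq (-Real.pi) 0
  rw [show -Real.pi + 2 * Real.pi = Real.pi by ring, zero_add] at hshift
  rw [hshift]
  exact havg.resolve_left (by positivity)

theorem two_pi_mul_le_integral_norm_sq {t : ℂ → ℂ} (ht : DifferentiableOn ℂ t (ball 0 1)) (b : ℂ)
    {r : ℝ} (hr0 : 0 < r) (hr1 : r < 1) :
    2 * Real.pi * (1 + ‖b‖ ^ 2 * r ^ 4) ≤ ∫ θ in (-Real.pi)..Real.pi,
      ‖-1 + b * circleMap 0 r θ ^ 2 + circleMap 0 r θ ^ 3 * t (circleMap 0 r θ)‖ ^ 2 := by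
  let V : ℂ → ℂ := fun z ↦ -(b * z ^ 2) - z ^ 3 * t z + r ^ 4 * conj b * z * t z
  have hV : DifferentiableOn ℂ V (ball 0 1) := by fun_prop
  have hmaps (θ : ℝ) : circleMap 0 r θ ∈ ball (0 : ℂ) 1 := by
    simpa [abs_of_pos hr0] using hr1
  have hcont {h : ℂ → ℂ} (hh : DifferentiableOn ℂ h (ball 0 1)) :
      Continuous fun θ ↦ h (circleMap 0 r θ) :=
    hh.continuousOn.comp_continuous (continuous_circleMap 0 r) hmaps
  have hVcont := hcont hV
  have hre_cont : Continuous fun θ ↦ 2 * (V (circleMap 0 r θ)).re :=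
    continuous_const.mul (Complex.continuous_re.comp hVcont)
  have hsum : Continuous fun θ ↦ 1 + ‖b‖ ^ 2 * r ^ 4 + 2 * (V (circleMap 0 r θ)).re :=
    continuous_const.add hre_cont
  have hnorm : Continuous fun θ ↦
      ‖-1 + b * circleMap 0 r θ ^ 2 + circleMap 0 r θ ^ 3 * t (circleMap 0 r θ)‖ ^ 2 :=
    (hcont (h := fun z ↦ -1 + b * z ^ 2 + z ^ 3 * t z) (by fun_prop)).norm.pow 2
  have hpoint (θ : ℝ) : 1 + ‖b‖ ^ 2 * r ^ 4 + 2 * (V (circleMap 0 r θ)).re ≤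
      ‖-1 + b * circleMap 0 r θ ^ 2 + circleMap 0 r θ ^ 3 * t (circleMap 0 r θ)‖ ^ 2 := by
    have hz : ‖circleMap 0 r θ‖ = r := by simp [abs_of_pos hr0]
    generalize circleMap 0 r θ = z at hz
    have hzz : z * conj z = r ^ 2 := by rw [Complex.mul_conj']; rw [hz]
    have key : ‖-1 + b * z ^ 2 + z ^ 3 * t z‖ ^ 2 =
        1 + ‖b‖ ^ 2 * r ^ 4 + 2 * (V z).re + ‖z ^ 3 * t z‖ ^ 2 := by
      apply Complex.ofReal_injective
      push_cast
      rw [← Complex.mul_conj', ← Complex.mul_conj' b, ← Complex.mul_conj' (z ^ 3 * t z),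
        ← Complex.ofReal_ofNat, ← Complex.ofReal_mul, ← Complex.add_conj]
      simp only [V, map_add, map_sub, map_mul, map_pow, map_neg, map_one, Complex.conj_ofReal,
        Complex.conj_conj]
      rw [show (r : ℂ) ^ 4 = (z * conj z) ^ 2 by rw [hzz]; ring]
      ring
    rw [key]
    nlinarith [sq_nonneg ‖z ^ 3 * t z‖]
  calc 2 * Real.pi * (1 + ‖b‖ ^ 2 * r ^ 4)
      = ∫ θ in (-Real.pi)..Real.pi, (1 + ‖b‖ ^ 2 * r ^ 4 + 2 * (V (circleMap 0 r θ)).re) := by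
        have hre : ∫ θ in (-Real.pi)..Real.pi, (V (circleMap 0 r θ)).re = 0 := by
          have := Complex.reCLM.intervalIntegral_comp_comm (μ := volume)
            (hVcont.intervalIntegrable (-Real.pi) Real.pi)
          rw [integral_circleMap_eq_zero hV (by simp [V]) hr0 hr1] at this
          simpa using this
        rw [intervalIntegral.integral_add (by simp)
          (hre_cont.intervalIntegrable _ _),
          intervalIntegral.integral_const_mul, hre]
        simp
        ring
    _ ≤ _ := by
        refine intervalIntegral.integral_mono_on (by linarith [Real.pi_pos])
          (hsum.intervalIntegrable _ _) (hnorm.intervalIntegrable _ _) fun θ _ ↦ hpoint θ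

theorem ofReal_le_lintegral_circle {h t : ℂ → ℂ} (ht : DifferentiableOn ℂ t (ball 0 1)) (b : ℂ)
    {r : ℝ} (hr0 : 0 < r) (hr1 : r < 1)
    (hh : ∀ z : ℂ, ‖z‖ = r → z ^ 2 * h z = -1 + b * z ^ 2 + z ^ 3 * t z) :
    ENNReal.ofReal (2 * Real.pi * ((r ^ 3)⁻¹ + ‖b‖ ^ 2 * r)) ≤
      ∫⁻ θ in Set.Ioo (-Real.pi) Real.pi, ENNReal.ofReal (r * ‖h (circleMap 0 r θ)‖ ^ 2) := by
  have hnorm (θ : ℝ) : ‖circleMap 0 r θ‖ = r := by simp [abs_of_pos hr0]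
  have hmaps (θ : ℝ) : circleMap 0 r θ ∈ ball (0 : ℂ) 1 := by
    rw [mem_ball_zero_iff, hnorm]; exact hr1
  let k : ℂ → ℂ := fun z ↦ -1 + b * z ^ 2 + z ^ 3 * t z
  have hk : Continuous fun θ ↦ (r ^ 3)⁻¹ * ‖k (circleMap 0 r θ)‖ ^ 2 := by
    have hkd : DifferentiableOn ℂ k (ball 0 1) := by fun_prop
    exact continuous_const.mul
      ((hkd.continuousOn.comp_continuous (continuous_circleMap 0 r) hmaps).norm.pow 2)
  have hval (θ : ℝ) : r * ‖h (circleMap 0 r θ)‖ ^ 2 = (r ^ 3)⁻¹ * ‖k (circleMap 0 r θ)‖ ^ 2 := by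
    simp only [k]
    rw [← hh _ (hnorm θ), norm_mul, norm_pow, hnorm]
    field_simp
  simp_rw [hval]
  rw [← ofReal_integral_eq_lintegral_ofReal
    (hk.integrableOn_Icc.mono_set Set.Ioo_subset_Icc_self)
    (Eventually.of_forall fun θ ↦ by simp only [Pi.zero_apply]; positivity)]
  refine ENNReal.ofReal_le_ofReal ?_
  rw [integral_const_mul, ← integral_Ioc_eq_integral_Ioo,
    ← intervalIntegral.integral_of_le (by linarith [Real.pi_pos])]
  calc 2 * Real.pi * ((r ^ 3)⁻¹ + ‖b‖ ^ 2 * r)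
      = (r ^ 3)⁻¹ * (2 * Real.pi * (1 + ‖b‖ ^ 2 * r ^ 4)) := by field_simp
    _ ≤ _ := by
      gcongr
      exact two_pi_mul_le_integral_norm_sq ht b hr0 hr1

theorem ofReal_le_lintegral_annulus {h t : ℂ → ℂ} (ht : DifferentiableOn ℂ t (ball 0 1)) (b : ℂ)
    (hmeas : Measurable h) {ρ : ℝ} (hρ0 : 0 < ρ) (hρ1 : ρ < 1)
    (hh : ∀ z : ℂ, ρ < ‖z‖ → ‖z‖ < 1 → z ^ 2 * h z = -1 + b * z ^ 2 + z ^ 3 * t z) :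
    ENNReal.ofReal (Real.pi * ((ρ ^ 2)⁻¹ - 1 + ‖b‖ ^ 2 * (1 - ρ ^ 2))) ≤
      ∫⁻ z in {z : ℂ | ρ < ‖z‖ ∧ ‖z‖ < 1}, ENNReal.ofReal (‖h z‖ ^ 2) := by
  have hA : MeasurableSet {z : ℂ | ρ < ‖z‖ ∧ ‖z‖ < 1} :=
    ((isOpen_lt continuous_const continuous_norm).inter
      (isOpen_lt continuous_norm continuous_const)).measurableSet
  let W : ℂ → ENNReal :=
    Set.indicator {z : ℂ | ρ < ‖z‖ ∧ ‖z‖ < 1} fun z ↦ ENNReal.ofReal (‖h z‖ ^ 2)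
  have hW : Measurable W := (hmeas.norm.pow_const 2).ennreal_ofReal.indicator hA
  have hpolar : Measurable (Complex.polarCoord.symm : ℝ × ℝ → ℂ) := by
    have : (Complex.polarCoord.symm : ℝ × ℝ → ℂ) =
        fun p ↦ p.1 * (Real.cos p.2 + Real.sin p.2 * Complex.I) :=
      funext Complex.polarCoord_symm_apply
    rw [this]
    fun_prop
  have hcircle (r θ : ℝ) : Complex.polarCoord.symm (r, θ) = circleMap 0 r θ := by
    simp [circleMap, Complex.exp_mul_I]
  rw [← lintegral_indicator hA, ← Complex.lintegral_comp_polarCoord_symm, polarCoord_target,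
    Measure.volume_eq_prod, ← Measure.prod_restrict, lintegral_prod _ (by
      refine Measurable.aemeasurable ?_
      simp only [smul_eq_mul]
      exact (measurable_fst.ennreal_ofReal).mul (hW.comp hpolar))]
  have hinner (r : ℝ) (hr : r ∈ Set.Ioo ρ 1) :
      ENNReal.ofReal (2 * Real.pi * ((r ^ 3)⁻¹ + ‖b‖ ^ 2 * r)) ≤
        ∫⁻ θ in Set.Ioo (-Real.pi) Real.pi,
          ENNReal.ofReal r • W (Complex.polarCoord.symm (r, θ)) := by
    have hr0 : 0 < r := hρ0.trans hr.1
    have hnorm (θ : ℝ) : ‖circleMap 0 r θ‖ = r := by simp [abs_of_pos hr0]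
    refine (ofReal_le_lintegral_circle ht b hr0 hr.2 fun z hz ↦
      hh z (hz ▸ hr.1) (hz ▸ hr.2)).trans_eq (lintegral_congr fun θ ↦ ?_)
    rw [hcircle, smul_eq_mul, ENNReal.ofReal_mul hr0.le]
    simp only [W]
    rw [Set.indicator_of_mem (by rw [Set.mem_ofPred_eq, hnorm]; exact hr)]
  have hsub : Set.Ioo ρ 1 ⊆ Set.Ioi 0 := fun r hr ↦ hρ0.trans hr.1
  refine le_trans ?_ (lintegral_mono_set hsub)
  refine le_trans ?_ (setLIntegral_mono' measurableSet_Ioo hinner)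
  have hne {r : ℝ} (hr : r ∈ Set.Icc ρ 1) : r ≠ 0 := (hρ0.trans_le hr.1).ne'
  have hcont : ContinuousOn (fun r : ℝ ↦ 2 * Real.pi * ((r ^ 3)⁻¹ + ‖b‖ ^ 2 * r))
      (Set.Icc ρ 1) := by
    have : ContinuousOn (fun r : ℝ ↦ (r ^ 3)⁻¹) (Set.Icc ρ 1) :=
      (continuousOn_pow 3).inv₀ fun r hr ↦ pow_ne_zero 3 (hne hr)
    fun_prop
  rw [← ofReal_integral_eq_lintegral_ofReal
    (hcont.integrableOn_Icc.mono_set Set.Ioo_subset_Icc_self)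
    ((ae_restrict_iff' measurableSet_Ioo).2 (Eventually.of_forall fun r hr ↦ by
      have : 0 < r := hsub hr
      simp only [Pi.zero_apply]; positivity))]
  refine le_of_eq (congrArg _ ?_)
  rw [← integral_Ioc_eq_integral_Ioo, ← intervalIntegral.integral_of_le hρ1.le,
    intervalIntegral.integral_eq_sub_of_hasDerivAt
      (f := fun r ↦ Real.pi * (-(r ^ 2)⁻¹ + ‖b‖ ^ 2 * r ^ 2))]
  · ring
  · intro r hr
    rw [Set.uIcc_of_le hρ1.le] at hr
    have hr0 := hne hr
    have h1 := ((hasDerivAt_pow 2 r).inv (pow_ne_zero 2 hr0)).neg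
    have h2 := ((h1.add ((hasDerivAt_pow 2 r).const_mul (‖b‖ ^ 2))).const_mul Real.pi)
    refine h2.congr_deriv ?_
    norm_num
    field_simp
  · refine ContinuousOn.intervalIntegrable ?_
    rwa [Set.uIcc_of_le hρ1.le]

theorem isOpen_image_of_injOn {g : ℂ → ℂ} {U : Set ℂ} (hU : IsOpen U)
    (hg : DifferentiableOn ℂ g U) (hinj : Set.InjOn g U) : IsOpen (g '' U) := by
  rw [isOpen_iff_mem_nhds]
  rintro _ ⟨z, hz, rfl⟩
  have hUz := hU.mem_nhds hz
  rcases (hg.analyticAt hUz).eventually_constant_or_nhds_le_map_nhds with hconst | hle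
  · exfalso
    have hsing : ∀ᶠ x in 𝓝 z, x = z := by
      filter_upwards [hconst, hUz] with x hx hxU using hinj hxU hz hx
    have : ∀ᶠ x in 𝓝[≠] z, False := by
      filter_upwards [hsing.filter_mono nhdsWithin_le_nhds, self_mem_nhdsWithin] with x hx hne
        using hne hx
    exact (NeBot.ne inferInstance) (eventually_false_iff_eq_bot.1 this)
  · exact hle (image_mem_map hUz)

theorem lintegral_norm_deriv_sq_eq_volume_image {g : ℂ → ℂ} {U : Set ℂ} (hU : IsOpen U)
    (hg : DifferentiableOn ℂ g U) (hinj : Set.InjOn g U) :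
    ∫⁻ z in U, ENNReal.ofReal (‖deriv g z‖ ^ 2) = volume (g '' U) := by
  rw [← lintegral_abs_det_fderiv_eq_addHaar_image volume hU.measurableSet
    (f' := fun z ↦ LinearMap.toContinuousLinearMap (addConjMap (deriv g z) 0)) _ hinj]
  · refine lintegral_congr fun z ↦ ?_
    simp [ContinuousLinearMap.det, det_addConjMap]
  · intro z hz
    have h := (hg.differentiableAt (hU.mem_nhds hz)).hasDerivAt.hasFDerivAt.restrictScalars ℝ
    refine (h.congr_fderiv ?_).hasFDerivWithinAt
    ext x
    simp [mul_comm]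

theorem norm_le_one_of_forall_area_le {β M ε : ℝ} (hβ : 0 ≤ β) (hε : 0 < ε)
    (h : ∀ ρ : ℝ, 0 < ρ → ρ < ε →
      (1 - ρ ^ 2 + β ^ 2 * ρ ^ 2 * (1 - ρ ^ 2)) * (1 - β ^ 2 * ρ ^ 4) ≤ (1 + M * ρ ^ 3) ^ 2) :
    β ≤ 1 := by
  have hlim : Tendsto (fun ρ : ℝ ↦ 2 * M * ρ + M ^ 2 * ρ ^ 4 + β ^ 2 * ρ ^ 2 +
      β ^ 2 * ρ ^ 2 * (1 - ρ ^ 2 + β ^ 2 * ρ ^ 2 * (1 - ρ ^ 2))) (𝓝[>] 0) (𝓝 0) := by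
    refine tendsto_nhdsWithin_of_tendsto_nhds ?_
    exact Continuous.tendsto' (by fun_prop) _ _ (by simp)
  have hle : β ^ 2 - 1 ≤ 0 := by
    refine ge_of_tendsto hlim ?_
    filter_upwards [Ioo_mem_nhdsGT hε] with ρ hρ
    have hρ2 : 0 < ρ ^ 2 := pow_pos hρ.1 2
    refine le_of_mul_le_mul_left ?_ hρ2
    linarith [h ρ hρ.1 hρ.2]
  nlinarith

theorem tendsto_norm_inv_add_atTop {b : ℂ} {q : ℂ → ℂ} (hq : ContinuousAt q 0) :
    Tendsto (fun z : ℂ ↦ ‖z⁻¹ + b * z + z ^ 2 * q z‖) (𝓝[≠] 0) atTop := by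
  have hrest : Tendsto (fun z : ℂ ↦ -‖b * z + z ^ 2 * q z‖) (𝓝[≠] 0)
      (𝓝 (-‖b * 0 + 0 ^ 2 * q 0‖)) := by
    refine tendsto_nhdsWithin_of_tendsto_nhds ?_
    have : ContinuousAt (fun z : ℂ ↦ -‖b * z + z ^ 2 * q z‖) 0 := by fun_prop
    exact this
  refine tendsto_atTop_mono (fun z ↦ ?_) (tendsto_norm_inv_nhdsNE_zero_atTop.atTop_add hrest)
  have := norm_sub_norm_le (z⁻¹) (-(b * z + z ^ 2 * q z))
  rw [norm_neg, sub_neg_eq_add, ← add_assoc] at this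
  linarith

theorem norm_sub_mul_conj_inv_add_le {b q z : ℂ} {ρ M : ℝ} (hz : ‖z‖ = ρ) (hρ : 0 < ρ)
    (hb : ‖b‖ * ρ ^ 2 ≤ 1) (hq : ‖q‖ ≤ M) :
    ‖(z⁻¹ + b * z + z ^ 2 * q) - (b * ρ ^ 2) * conj (z⁻¹ + b * z + z ^ 2 * q)‖ ≤
      ρ⁻¹ + 2 * M * ρ ^ 2 := by
  have hz0 : z ≠ 0 := norm_pos_iff.1 (hz ▸ hρ)
  have hzz : z * conj z = ρ ^ 2 := by rw [Complex.mul_conj', hz]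
  have hcz : conj z ≠ 0 := by simpa using hz0
  have hbb : b * conj b = ‖b‖ ^ 2 := Complex.mul_conj' b
  have heq : (z⁻¹ + b * z + z ^ 2 * q) - (b * ρ ^ 2) * conj (z⁻¹ + b * z + z ^ 2 * q) =
      ((1 - (‖b‖ * ρ ^ 2) ^ 2 : ℝ) : ℂ) * z⁻¹ + z ^ 2 * q -
        (b * ρ ^ 2) * (conj z ^ 2 * conj q) := by
    push_cast
    rw [mul_pow, ← hbb, ← hzz]
    simp only [map_add, map_mul, map_pow, map_inv₀]
    field_simp
    ring
  have hM : ‖z ^ 2 * q‖ ≤ ρ ^ 2 * M := by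
    rw [norm_mul, norm_pow, hz]; gcongr
  have hM' : ‖(b * ρ ^ 2) * (conj z ^ 2 * conj q)‖ ≤ ρ ^ 2 * M := by
    rw [norm_mul, ← map_pow, ← map_mul, RCLike.norm_conj, norm_mul b, norm_pow,
      Complex.norm_real, Real.norm_of_nonneg hρ.le]
    calc ‖b‖ * ρ ^ 2 * ‖z ^ 2 * q‖ ≤ 1 * (ρ ^ 2 * M) := by gcongr
      _ = _ := one_mul _
  have hmain : ‖((1 - (‖b‖ * ρ ^ 2) ^ 2 : ℝ) : ℂ) * z⁻¹‖ ≤ ρ⁻¹ := by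
    rw [norm_mul, norm_inv, hz, Complex.norm_real]
    have h0 : 0 ≤ ‖b‖ * ρ ^ 2 := by positivity
    have : |1 - (‖b‖ * ρ ^ 2) ^ 2| ≤ 1 := abs_le.2 ⟨by nlinarith, by nlinarith⟩
    exact mul_le_of_le_one_left (by positivity) this
  rw [heq]
  have h1 := norm_sub_le (((1 - (‖b‖ * ρ ^ 2) ^ 2 : ℝ) : ℂ) * z⁻¹ + z ^ 2 * q)
    ((b * ρ ^ 2) * (conj z ^ 2 * conj q))
  have h2 := norm_add_le (((1 - (‖b‖ * ρ ^ 2) ^ 2 : ℝ) : ℂ) * z⁻¹) (z ^ 2 * q)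
  linarith

/-- A weak form of Gronwall's area theorem: if `z ↦ 1/z + b z + z² q(z)` is injective on the
punctured unit disc, then `|b| ≤ 1`. -/
theorem norm_le_one_of_injOn_inv_add {b : ℂ} {q : ℂ → ℂ} (hq : DifferentiableOn ℂ q (ball 0 1))
    (hinj : Set.InjOn (fun z : ℂ ↦ z⁻¹ + b * z + z ^ 2 * q z) (ball 0 1 \ {0})) : ‖b‖ ≤ 1 := by
  set g : ℂ → ℂ := fun z ↦ z⁻¹ + b * z + z ^ 2 * q z with hg
  have hqder := hq.deriv isOpen_ball
  have hUopen : IsOpen (ball (0 : ℂ) 1 \ {0}) := isOpen_ball.sdiff isClosed_singleton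
  have hgder {z : ℂ} (hz : z ∈ ball (0 : ℂ) 1 \ {0}) :
      HasDerivAt g (-(z ^ 2)⁻¹ + b + (2 * z * q z + z ^ 2 * deriv q z)) z := by
    have hqz := (hq.differentiableAt (isOpen_ball.mem_nhds hz.1)).hasDerivAt
    have h := ((hasDerivAt_inv (show z ≠ 0 from hz.2)).add ((hasDerivAt_id z).const_mul b)).add
      ((hasDerivAt_pow 2 z).mul hqz)
    exact h.congr_deriv (by simp)
  have hgdiff : DifferentiableOn ℂ g (ball 0 1 \ {0}) := fun z hz ↦
    (hgder hz).differentiableAt.differentiableWithinAt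
  obtain ⟨M, hM⟩ := (isCompact_closedBall (0 : ℂ) (1 / 2)).exists_bound_of_continuousOn
    (hq.continuousOn.mono (closedBall_subset_ball (by norm_num)))
  refine norm_le_one_of_forall_area_le (norm_nonneg b) (M := 2 * M)
    (show 0 < min (1 / 2) (1 / (‖b‖ + 1)) by positivity) fun ρ hρ0 hρ ↦ ?_
  have hρ2 : ρ < 1 / 2 := hρ.trans_le (min_le_left _ _)
  have hρ1 : ρ < 1 := by linarith
  have hbρ : ‖b‖ * ρ ^ 2 < 1 := by
    have h1 : ρ < 1 / (‖b‖ + 1) := hρ.trans_le (min_le_right _ _)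
    rw [lt_div_iff₀ (by positivity)] at h1
    nlinarith [norm_nonneg b]
  have hM0 : 0 ≤ M := (norm_nonneg _).trans (hM 0 (by simp))
  set c : ℂ := b * ρ ^ 2 with hc
  have hcnorm : ‖c‖ = ‖b‖ * ρ ^ 2 := by
    rw [hc, norm_mul, norm_pow, Complex.norm_real, Real.norm_of_nonneg hρ0.le]
  have hc1 : ‖c‖ < 1 := hcnorm ▸ hbρ
  set R : ℝ := ρ⁻¹ + 2 * M * ρ ^ 2 with hR
  have hR0 : 0 ≤ R := by positivity
  have hcover : {w : ℂ | R < ‖w - c * conj w‖} ⊆ g '' (ball 0 ρ \ {0}) := by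
    have hsub : ball (0 : ℂ) ρ \ {0} ⊆ ball 0 1 \ {0} :=
      Set.sdiff_subset_sdiff_left (ball_subset_ball hρ1.le)
    have hlim : Tendsto (fun z ↦ ‖g z‖) (𝓝[≠] 0) atTop :=
      tendsto_norm_inv_add_atTop
        (hq.differentiableAt (isOpen_ball.mem_nhds (mem_ball_self one_pos))).continuousAt
    refine subset_image_punctured_ball
      (hgdiff.continuousOn.mono (Set.sdiff_subset_sdiff_left (closedBall_subset_ball hρ1)))
      (isOpen_image_of_injOn (isOpen_ball.sdiff isClosed_singleton) (hgdiff.mono hsub)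
        (hinj.mono hsub)) hlim (isPreconnected_setOf_lt_norm_sub_mul_conj hc1 hR0) ?_ ?_
    · have hball : ∀ᶠ z in 𝓝[≠] (0 : ℂ), z ∈ ball (0 : ℂ) ρ :=
        nhdsWithin_le_nhds (ball_mem_nhds 0 hρ0)
      obtain ⟨z, hz, hzρ, hz0⟩ := ((hlim.eventually_gt_atTop (R / (1 - ‖c‖))).and
        (hball.and self_mem_nhdsWithin)).exists
      refine ⟨g z, ?_, z, ⟨hzρ, hz0⟩, rfl⟩
      rw [div_lt_iff₀ (by linarith)] at hz
      have := norm_sub_norm_le (g z) (c * conj (g z))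
      rw [norm_mul, RCLike.norm_conj] at this
      rw [Set.mem_ofPred_eq]
      linarith
    · intro z hz
      rw [mem_sphere_zero_iff_norm] at hz
      rw [Set.mem_ofPred_eq, not_lt]
      exact norm_sub_mul_conj_inv_add_le hz hρ0 hbρ.le (hM z (by simp [hz]; linarith))
  set A : Set ℂ := {z : ℂ | ρ < ‖z‖ ∧ ‖z‖ < 1} with hA
  have hAopen : IsOpen A := (isOpen_lt continuous_const continuous_norm).inter
      (isOpen_lt continuous_norm continuous_const)
  have hAsub : A ⊆ ball 0 1 \ {0} := fun z hz ↦
    ⟨mem_ball_zero_iff.2 hz.2, norm_pos_iff.1 (hρ0.trans hz.1)⟩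
  have himage : g '' A ⊆ {w : ℂ | ‖w - c * conj w‖ ≤ R} := by
    rintro _ ⟨z, hz, rfl⟩
    rw [Set.mem_ofPred_eq]
    by_contra! hcon
    obtain ⟨z', hz', heq⟩ := hcover hcon
    have : z' = z := hinj ⟨ball_subset_ball hρ1.le hz'.1, hz'.2⟩ (hAsub hz) heq
    exact lt_asymm (this ▸ mem_ball_zero_iff.1 hz'.1) hz.1
  have harea := (ofReal_le_lintegral_annulus (h := deriv g) (t := fun z ↦ 2 * q z + z * deriv q z)
    (by fun_prop) b (measurable_deriv g) hρ0 hρ1 fun z hz1 hz2 ↦ by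
      have hz0 : z ≠ 0 := (hAsub ⟨hz1, hz2⟩).2
      rw [(hgder (hAsub ⟨hz1, hz2⟩)).deriv]
      field_simp).trans_eq (lintegral_norm_deriv_sq_eq_volume_image hAopen (hgdiff.mono hAsub)
        (hinj.mono hAsub))
  have harea' := harea.trans ((measure_mono himage).trans_eq (volume_setOf_norm_sub_mul_conj_le hc1 hR0))
  have hpos : 0 < 1 - ‖c‖ ^ 2 := by nlinarith [norm_nonneg c]
  rw [ENNReal.ofReal_le_ofReal_iff (by positivity), mul_div_assoc,
    mul_le_mul_iff_right₀ Real.pi_pos, le_div_iff₀ hpos, hcnorm] at harea'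
  have := mul_le_mul_of_nonneg_left harea' (sq_nonneg ρ)
  rw [hR] at this
  have e1 : ρ ^ 2 * (((ρ ^ 2)⁻¹ - 1 + ‖b‖ ^ 2 * (1 - ρ ^ 2)) * (1 - (‖b‖ * ρ ^ 2) ^ 2)) =
      (1 - ρ ^ 2 + ‖b‖ ^ 2 * ρ ^ 2 * (1 - ρ ^ 2)) * (1 - ‖b‖ ^ 2 * ρ ^ 4) := by
    field_simp
  have e2 : ρ ^ 2 * (ρ⁻¹ + 2 * M * ρ ^ 2) ^ 2 = (1 + 2 * M * ρ ^ 3) ^ 2 := by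
    field_simp
  rwa [e1, e2] at this

theorem exists_sq_mul_eq_one {φ : ℂ → ℂ} (hφ : DifferentiableOn ℂ φ (ball 0 1))
    (hne : ∀ z ∈ ball (0 : ℂ) 1, φ z ≠ 0) (hφ0 : φ 0 = 1) :
    ∃ χ : ℂ → ℂ, DifferentiableOn ℂ χ (ball 0 1) ∧ χ 0 = 1 ∧
      ∀ z ∈ ball (0 : ℂ) 1, χ z ^ 2 * φ z = 1 := by
  obtain ⟨L, hL⟩ := ((hφ.deriv isOpen_ball).div hφ hne).isExactOn_ball
  have hLd : DifferentiableOn ℂ L (ball 0 1) := fun z hz ↦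
    (hL z hz).differentiableAt.differentiableWithinAt
  refine ⟨fun z ↦ Complex.exp ((L 0 - L z) / 2), by fun_prop, by simp, fun z hz ↦ ?_⟩
  have hconst := isOpen_ball.is_const_of_deriv_eq_zero
    (f := fun z ↦ Complex.exp (L 0 - L z) * φ z) (convex_ball (0 : ℂ) 1).isPreconnected
    (by fun_prop) (fun w hw ↦ by
      have h := ((hL w hw).const_sub (L 0)).cexp.mul
        (hφ.differentiableAt (isOpen_ball.mem_nhds hw)).hasDerivAt
      have hw0 := hne w hw
      refine h.deriv.trans ?_
      simp only [Pi.div_apply, Pi.zero_apply]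
      field_simp
      ring) hz (mem_ball_self one_pos)
  rw [← Complex.exp_nat_mul]
  simpa [hφ0, mul_div_cancel₀] using hconst

theorem deriv_deriv_eq_two_mul_deriv_dslope {f : ℂ → ℂ} (hf : DifferentiableOn ℂ f (ball 0 1)) :
    deriv (deriv f) 0 = 2 * deriv (dslope f 0) 0 := by
  have h0 : (0 : ℂ) ∈ ball (0 : ℂ) 1 := mem_ball_self one_pos
  have hD : DifferentiableOn ℂ (dslope f 0) (ball 0 1) :=
    (Complex.differentiableOn_dslope (isOpen_ball.mem_nhds h0)).2 hf
  have hfD : f = fun z ↦ f 0 + z * dslope f 0 z := by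
    funext z
    have := sub_smul_dslope f 0 z
    rw [sub_zero, smul_eq_mul] at this
    rw [this]
    ring
  have hderiv : deriv f =ᶠ[𝓝 0] fun z ↦ dslope f 0 z + z * deriv (dslope f 0) z := by
    filter_upwards [isOpen_ball.mem_nhds h0] with z hz
    have h := ((hasDerivAt_id z).mul
      (hD.differentiableAt (isOpen_ball.mem_nhds hz)).hasDerivAt).const_add (f 0)
    conv_lhs => rw [hfD]
    exact h.deriv.trans (by simp)
  rw [hderiv.deriv_eq]
  have h1 := (hD.differentiableAt (isOpen_ball.mem_nhds h0)).hasDerivAt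
  have h2 := ((hD.deriv isOpen_ball).differentiableAt (isOpen_ball.mem_nhds h0)).hasDerivAt
  exact (h1.add ((hasDerivAt_id 0).mul h2)).deriv.trans (by simp; ring)

/-- Bieberbach's inequality for the second coefficient of an injective holomorphic function. -/
theorem norm_deriv_deriv_zero_le_of_injOn {f : ℂ → ℂ} (hf : DifferentiableOn ℂ f (ball 0 1))
    (hinj : Set.InjOn f (ball 0 1)) (hf1 : deriv f 0 ≠ 0) :
    ‖deriv (deriv f) 0‖ ≤ 4 * ‖deriv f 0‖ := by
  have h0 : (0 : ℂ) ∈ ball (0 : ℂ) 1 := mem_ball_self one_pos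
  have h0n := isOpen_ball.mem_nhds h0
  have hD : DifferentiableOn ℂ (dslope f 0) (ball 0 1) :=
    (Complex.differentiableOn_dslope h0n).2 hf
  have hfD (z : ℂ) : f z = f 0 + z * dslope f 0 z := by
    have := sub_smul_dslope f 0 z
    rw [sub_zero, smul_eq_mul] at this
    rw [this]
    ring
  have hDne : ∀ z ∈ ball (0 : ℂ) 1, dslope f 0 z / deriv f 0 ≠ 0 := by
    intro z hz
    refine div_ne_zero (fun h ↦ ?_) hf1
    by_cases hz0 : z = 0
    · rw [hz0, dslope_same] at h
      exact hf1 h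
    · exact hz0 (hinj hz h0 (by rw [hfD z, h]; simp))
  obtain ⟨χ, hχ, hχ0, hχsq⟩ := exists_sq_mul_eq_one (φ := fun z ↦ dslope f 0 z / deriv f 0)
    (hD.div_const _) hDne (by simp [hf1])
  have hχ1 : DifferentiableOn ℂ (dslope χ 0) (ball 0 1) :=
    (Complex.differentiableOn_dslope h0n).2 hχ
  have hχ2 : DifferentiableOn ℂ (dslope (dslope χ 0) 0) (ball 0 1) :=
    (Complex.differentiableOn_dslope h0n).2 hχ1
  have hsqmaps : Set.MapsTo (fun z : ℂ ↦ z ^ 2) (ball 0 1) (ball 0 1) := by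
    intro z hz
    rw [mem_ball_zero_iff] at hz ⊢
    rw [norm_pow]
    exact pow_lt_one₀ (norm_nonneg z) hz two_ne_zero
  have hχexp (u : ℂ) : χ u = 1 + u * (deriv χ 0 + u * dslope (dslope χ 0) 0 u) := by
    have e1 := sub_smul_dslope χ 0 u
    have e2 := sub_smul_dslope (dslope χ 0) 0 u
    rw [sub_zero, smul_eq_mul] at e1 e2
    rw [dslope_same] at e2
    rw [hχ0] at e1
    linear_combination -e1 - u * e2
  have hb : ‖deriv χ 0‖ ≤ 1 := by
    refine norm_le_one_of_injOn_inv_add (q := fun z ↦ z * dslope (dslope χ 0) 0 (z ^ 2))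
      (differentiableOn_id.mul (hχ2.comp (by fun_prop) hsqmaps)) ?_
    have hg {z : ℂ} (hz : z ∈ ball (0 : ℂ) 1 \ {0}) :
        z⁻¹ + deriv χ 0 * z + z ^ 2 * (z * dslope (dslope χ 0) 0 (z ^ 2)) = χ (z ^ 2) / z := by
      have hz0 : z ≠ 0 := hz.2
      rw [hχexp]
      field_simp
      ring
    have hgsq {z : ℂ} (hz : z ∈ ball (0 : ℂ) 1 \ {0}) :
        (χ (z ^ 2) / z) ^ 2 * (f (z ^ 2) - f 0) = deriv f 0 := by
      have hz0 : z ≠ 0 := hz.2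
      have := hχsq _ (hsqmaps hz.1)
      rw [hfD]
      field_simp at this ⊢
      rw [← this]
      ring
    intro z hz w hw hzw
    simp only at hzw
    rw [hg hz, hg hw] at hzw
    have hgz := hgsq hz
    have hgw := hgsq hw
    rw [hzw] at hgz
    have hgne : χ (w ^ 2) / w ≠ 0 := by
      intro h
      rw [h] at hgw
      exact hf1 (by rw [← hgw]; ring)
    have hfeq : f (z ^ 2) = f (w ^ 2) := by
      have := mul_left_cancel₀ (pow_ne_zero 2 hgne) (hgz.trans hgw.symm)
      exact sub_left_injective this
    have hsq := hinj (hsqmaps hz.1) (hsqmaps hw.1) hfeq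
    rcases sq_eq_sq_iff_eq_or_eq_neg.1 hsq with h | h
    · exact h
    · exfalso
      rw [h, neg_sq, div_neg] at hzw
      exact hgne (self_eq_neg.1 hzw.symm)
  have hrel : 2 * deriv χ 0 * deriv f 0 + deriv (dslope f 0) 0 = 0 := by
    have h1 := (hχ.differentiableAt h0n).hasDerivAt
    have h2 := (hD.differentiableAt h0n).hasDerivAt.div_const (deriv f 0)
    have h3 := (h1.pow 2).mul h2
    have h4 : (fun z ↦ χ z ^ 2 * (dslope f 0 z / deriv f 0)) =ᶠ[𝓝 0] fun _ ↦ (1 : ℂ) := by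
      filter_upwards [h0n] with z hz using hχsq z hz
    have h5 := h3.deriv.symm.trans (h4.deriv_eq.trans (deriv_const _ _))
    simp only [Pi.pow_apply, hχ0, dslope_same] at h5
    field_simp at h5
    norm_num at h5
    linear_combination h5
  have hval : deriv (deriv f) 0 = -4 * (deriv χ 0 * deriv f 0) := by
    rw [deriv_deriv_eq_two_mul_deriv_dslope hf]
    linear_combination 2 * hrel
  rw [hval, norm_mul, norm_mul, norm_neg, Complex.norm_ofNat]
  have := mul_le_mul_of_nonneg_right hb (norm_nonneg (deriv f 0))
  linarith

theorem norm_sub_two_conj_mul_deriv_le_of_ne {f : ℂ → ℂ} (hf : DifferentiableOn ℂ f (ball 0 1))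
    (hinj : Set.InjOn f (ball 0 1)) {z : ℂ} (hz : z ∈ ball (0 : ℂ) 1) (hfz : deriv f z ≠ 0) :
    ‖(1 - ‖z‖ ^ 2 : ℂ) * deriv (deriv f) z - 2 * conj z * deriv f z‖ ≤ 4 * ‖deriv f z‖ := by
  have hz1 : ‖z‖ < 1 := mem_ball_zero_iff.1 hz
  have hpos : 0 < 1 - ‖z‖ ^ 2 := by nlinarith [norm_nonneg z]
  have hzz : z * conj z = ‖z‖ ^ 2 := Complex.mul_conj' z
  have h0 : (0 : ℂ) ∈ ball (0 : ℂ) 1 := mem_ball_self one_pos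
  have hden {ζ : ℂ} (hζ : ζ ∈ ball (0 : ℂ) 1) : 1 + conj z * ζ ≠ 0 := by
    intro h
    have h1 : ‖conj z * ζ‖ = 1 := by
      rw [← norm_neg, ← eq_neg_of_add_eq_zero_left h, norm_one]
    rw [norm_mul, RCLike.norm_conj] at h1
    have h2 : ‖ζ‖ < 1 := mem_ball_zero_iff.1 hζ
    nlinarith [norm_nonneg z, norm_nonneg ζ]
  let m : ℂ → ℂ := fun ζ ↦ (ζ + z) / (1 + conj z * ζ)
  have hmaps : Set.MapsTo m (ball 0 1) (ball 0 1) := by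
    intro ζ hζ
    have hd := hden hζ
    have hζ1 : ‖ζ‖ < 1 := mem_ball_zero_iff.1 hζ
    rw [mem_ball_zero_iff, norm_div, div_lt_one (norm_pos_iff.2 hd)]
    refine lt_of_pow_lt_pow_left₀ 2 (norm_nonneg _) ?_
    have key : ‖1 + conj z * ζ‖ ^ 2 - ‖ζ + z‖ ^ 2 = (1 - ‖z‖ ^ 2) * (1 - ‖ζ‖ ^ 2) := by
      apply Complex.ofReal_injective
      push_cast
      rw [← Complex.mul_conj', ← Complex.mul_conj', ← Complex.mul_conj', ← Complex.mul_conj']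
      simp only [map_add, map_mul, map_one, Complex.conj_conj]
      ring
    have : 0 < (1 - ‖z‖ ^ 2) * (1 - ‖ζ‖ ^ 2) :=
      mul_pos hpos (by nlinarith [norm_nonneg ζ])
    linarith
  have hposc : (1 : ℂ) - ‖z‖ ^ 2 ≠ 0 := by exact_mod_cast hpos.ne'
  have hminj : Set.InjOn m (ball 0 1) := by
    intro ζ hζ ξ hξ h
    have hd := hden hζ
    have hd' := hden hξ
    simp only [m] at h
    rw [div_eq_div_iff hd hd'] at h
    refine mul_left_cancel₀ hposc ?_
    rw [← hzz]
    linear_combination h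
  have hmder {ζ : ℂ} (hζ : ζ ∈ ball (0 : ℂ) 1) :
      HasDerivAt m ((1 - ‖z‖ ^ 2) / (1 + conj z * ζ) ^ 2) ζ := by
    have hd := hden hζ
    refine (((hasDerivAt_id ζ).add_const z).div
      (((hasDerivAt_id ζ).const_mul (conj z)).const_add 1) hd).congr_deriv ?_
    rw [← hzz]
    simp only [id]
    ring
  have hm0 : m 0 = z := by simp [m]
  have hFder {ζ : ℂ} (hζ : ζ ∈ ball (0 : ℂ) 1) :
      HasDerivAt (f ∘ m) (deriv f (m ζ) * ((1 - ‖z‖ ^ 2) / (1 + conj z * ζ) ^ 2)) ζ :=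
    (hf.differentiableAt (isOpen_ball.mem_nhds (hmaps hζ))).hasDerivAt.comp ζ (hmder hζ)
  have hF1 : deriv (f ∘ m) 0 = deriv f z * (1 - ‖z‖ ^ 2) := by
    rw [(hFder h0).deriv, hm0]
    simp
  have hF2 : deriv (deriv (f ∘ m)) 0 =
      (1 - ‖z‖ ^ 2) * ((1 - ‖z‖ ^ 2 : ℂ) * deriv (deriv f) z - 2 * conj z * deriv f z) := by
    have heq : deriv (f ∘ m) =ᶠ[𝓝 0]
        fun ζ ↦ deriv f (m ζ) * ((1 - ‖z‖ ^ 2) / (1 + conj z * ζ) ^ 2) := by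
      filter_upwards [isOpen_ball.mem_nhds h0] with ζ hζ using (hFder hζ).deriv
    rw [heq.deriv_eq]
    have hf2 := ((hf.deriv isOpen_ball).differentiableAt
      (isOpen_ball.mem_nhds (hmaps h0))).hasDerivAt.comp 0 (hmder h0)
    have hfrac := (hasDerivAt_const (0 : ℂ) (1 - ‖z‖ ^ 2 : ℂ)).div
      ((((hasDerivAt_id (0 : ℂ)).const_mul (conj z)).const_add 1).pow 2)
      (pow_ne_zero 2 (hden h0))
    refine (hf2.mul hfrac).deriv.trans ?_
    simp [hm0]
    ring
  have hB := norm_deriv_deriv_zero_le_of_injOn (f := f ∘ m)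
    (hf.comp (fun ζ hζ ↦ (hmder hζ).differentiableAt.differentiableWithinAt) hmaps)
    (hinj.comp hminj hmaps) (by rw [hF1]; exact mul_ne_zero hfz hposc)
  have hnorm : ‖(1 - ‖z‖ ^ 2 : ℂ)‖ = 1 - ‖z‖ ^ 2 := by
    rw [← Complex.ofReal_pow, ← Complex.ofReal_one, ← Complex.ofReal_sub, Complex.norm_real,
      Real.norm_of_nonneg hpos.le]
  rw [hF1, hF2, norm_mul, norm_mul _ (1 - ‖z‖ ^ 2 : ℂ), hnorm] at hB
  refine le_of_mul_le_mul_left ?_ hpos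
  linarith

theorem norm_sub_two_conj_mul_deriv_le {f : ℂ → ℂ} (hf : DifferentiableOn ℂ f (ball 0 1))
    (hinj : Set.InjOn f (ball 0 1)) (hf1 : deriv f 0 ≠ 0) {z : ℂ} (hz : z ∈ ball (0 : ℂ) 1) :
    ‖(1 - ‖z‖ ^ 2 : ℂ) * deriv (deriv f) z - 2 * conj z * deriv f z‖ ≤ 4 * ‖deriv f z‖ := by
  have hd := hf.deriv isOpen_ball
  have hzn := isOpen_ball.mem_nhds hz
  have hne : ∀ᶠ w in 𝓝[≠] z, deriv f w ≠ 0 := by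
    rcases (hd.analyticAt hzn).eventually_eq_zero_or_eventually_ne_zero with h | h
    · exact absurd ((hd.analyticOnNhd isOpen_ball).eqOn_zero_of_preconnected_of_eventuallyEq_zero
        (convex_ball (0 : ℂ) 1).isPreconnected hz h (mem_ball_self one_pos)) hf1
    · exact h
  have hc1 : ContinuousAt (deriv f) z := (hd.differentiableAt hzn).continuousAt
  have hc2 : ContinuousAt (deriv (deriv f)) z :=
    ((hd.deriv isOpen_ball).differentiableAt hzn).continuousAt
  have hc3 : ContinuousAt (fun w : ℂ ↦ conj w) z := Complex.continuous_conj.continuousAt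
  have hL : ContinuousAt (fun w : ℂ ↦
      ‖(1 - ‖w‖ ^ 2 : ℂ) * deriv (deriv f) w - 2 * conj w * deriv f w‖) z := by fun_prop
  have hR : ContinuousAt (fun w : ℂ ↦ 4 * ‖deriv f w‖) z := by fun_prop
  refine le_of_tendsto_of_tendsto (hL.mono_left (nhdsWithin_le_nhds (s := {z}ᶜ)))
    (hR.mono_left nhdsWithin_le_nhds) ?_
  filter_upwards [hne, nhdsWithin_le_nhds hzn] with w hw hwb
    using norm_sub_two_conj_mul_deriv_le_of_ne hf hinj hwb hw

theorem antitoneOn_norm_deriv_sq_mul {f : ℂ → ℂ} (hf : DifferentiableOn ℂ f (ball 0 1))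
    (hinj : Set.InjOn f (ball 0 1)) (hf1 : deriv f 0 ≠ 0) {e : ℂ} (he : ‖e‖ = 1) :
    AntitoneOn (fun t : ℝ ↦ ‖deriv f (t * e)‖ ^ 2 * ((1 - t) ^ 6 / (1 + t) ^ 2))
      (Set.Ioo (-1) 1) := by
  have hmem {t : ℝ} (ht : t ∈ Set.Ioo (-1 : ℝ) 1) : (t * e : ℂ) ∈ ball (0 : ℂ) 1 := by
    rw [mem_ball_zero_iff, norm_mul, he, mul_one, Complex.norm_real, Real.norm_eq_abs]
    exact abs_lt.2 ht
  have hder (t : ℝ) (ht : t ∈ Set.Ioo (-1 : ℝ) 1) :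
      HasDerivAt (fun t : ℝ ↦ ‖deriv f (t * e)‖ ^ 2 * ((1 - t) ^ 6 / (1 + t) ^ 2))
        (2 * inner ℝ (deriv f (t * e)) (deriv (deriv f) (t * e) * e) *
          ((1 - t) ^ 6 / (1 + t) ^ 2) +
        ‖deriv f (t * e)‖ ^ 2 * (-((1 - t) ^ 5 * (8 + 4 * t) / (1 + t) ^ 3))) t := by
    have ht1 : 1 + t ≠ 0 := by linarith [ht.1]
    have h1 := ((hf.deriv isOpen_ball).differentiableAt
      (isOpen_ball.mem_nhds (hmem ht))).hasDerivAt
    have h2 : HasDerivAt (fun t : ℝ ↦ (t * e : ℂ)) e t := by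
      simpa using (Complex.ofRealCLM.hasDerivAt (x := t)).mul_const e
    have h3 := (h1.comp t h2).norm_sq
    have h4 := (((hasDerivAt_id t).const_sub 1).pow 6).div (((hasDerivAt_id t).const_add 1).pow 2)
      (pow_ne_zero 2 ht1)
    refine (h3.mul h4).congr_deriv ?_
    simp only [Function.comp_apply, id, Pi.div_apply, Pi.pow_apply]
    congr 2
    field_simp
    ring
  refine antitoneOn_of_hasDerivWithinAt_nonpos (convex_Ioo _ _)
    (fun t ht ↦ (hder t ht).continuousAt.continuousWithinAt)
    (fun t ht ↦ (hder t (interior_subset ht)).hasDerivWithinAt) fun t ht ↦ ?_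
  rw [interior_Ioo] at ht
  have hp1 : 0 < 1 + t := by linarith [ht.1]
  have hp2 : 0 < 1 - t := by linarith [ht.2]
  have hB := norm_sub_two_conj_mul_deriv_le hf hinj hf1 (hmem ht)
  have hnorm : ‖(t * e : ℂ)‖ ^ 2 = t ^ 2 := by
    rw [norm_mul, he, mul_one, Complex.norm_real, Real.norm_eq_abs, sq_abs]
  rw [← Complex.ofReal_pow, hnorm] at hB
  generalize deriv f (t * e) = p at hB ⊢
  generalize deriv (deriv f) (t * e) = s at hB ⊢
  have hee : e * conj e = 1 := by rw [Complex.mul_conj', he]; simp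
  have hB' : ‖(1 - t ^ 2) • (s * e) - (2 * t) • p‖ ≤ 4 * ‖p‖ := by
    have : (1 - t ^ 2) • (s * e) - (2 * t) • p =
        ((1 - ((t ^ 2 : ℝ) : ℂ)) * s - 2 * conj (t * e) * p) * e := by
      simp only [Complex.real_smul, map_mul, Complex.conj_ofReal]
      push_cast
      linear_combination (-2 * t * p) * (-hee)
    rwa [this, norm_mul, he, mul_one]
  have hinner := (real_inner_le_norm p _).trans
    (mul_le_mul_of_nonneg_left hB' (norm_nonneg p))
  rw [inner_sub_right, real_inner_smul_right, real_inner_smul_right, real_inner_self_eq_norm_sq]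
    at hinner
  have hfac : 2 * inner ℝ p (s * e) * ((1 - t) ^ 6 / (1 + t) ^ 2) +
      ‖p‖ ^ 2 * (-((1 - t) ^ 5 * (8 + 4 * t) / (1 + t) ^ 3)) =
      2 * ((1 - t) ^ 5 / (1 + t) ^ 3) *
        ((1 - t ^ 2) * inner ℝ p (s * e) - 2 * t * ‖p‖ ^ 2 - ‖p‖ * (4 * ‖p‖)) := by
    field_simp
    ring
  rw [hfac]
  exact mul_nonpos_of_nonneg_of_nonpos (by positivity) (by linarith)

/-- **The Distortion Theorem.** For `f` in the class `S` and `|z| = r < 1`,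
`(1-r)/(1+r)³ ≤ |f'(z)| ≤ (1+r)/(1-r)³`. -/
theorem distortion_theorem (f : ℂ → ℂ)
    (hf : DifferentiableOn ℂ f (ball (0 : ℂ) 1))
    (hinj : Set.InjOn f (ball (0 : ℂ) 1))
    (hf0 : f 0 = 0) (hf1 : deriv f 0 = 1)
    (z : ℂ) (r : ℝ) (hz : ‖z‖ = r) (hr : r < 1) :
    (1 - r) / (1 + r) ^ 3 ≤ ‖deriv f z‖ ∧ ‖deriv f z‖ ≤ (1 + r) / (1 - r) ^ 3 := by
  have hr0 : 0 ≤ r := hz ▸ norm_nonneg z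
  have hr1 : 0 < 1 - r := by linarith
  have hne : deriv f 0 ≠ 0 := by simp [hf1]
  obtain ⟨e, he, rfl⟩ : ∃ e : ℂ, ‖e‖ = 1 ∧ r * e = z :=
    ⟨Complex.exp (z.arg * Complex.I), Complex.norm_exp_ofReal_mul_I _, by
      rw [← hz, Complex.norm_mul_exp_arg_mul_I]⟩
  have hmem0 : (0 : ℝ) ∈ Set.Ioo (-1 : ℝ) 1 := by simp
  constructor
  · have h := antitoneOn_norm_deriv_sq_mul hf hinj hne (e := -e) (by rwa [norm_neg])
      (show -r ∈ Set.Ioo (-1 : ℝ) 1 from ⟨by linarith, by linarith⟩) hmem0 (by linarith)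
    simp only [Complex.ofReal_neg, neg_mul_neg, Complex.ofReal_zero, zero_mul, hf1, norm_one,
      sub_neg_eq_add, sub_zero, add_zero, one_pow, div_one, mul_one, ← sub_eq_add_neg] at h
    refine le_of_sq_le_sq ?_ (norm_nonneg _)
    rw [div_pow, div_le_iff₀ (by positivity)]
    rw [← mul_div_assoc, le_div_iff₀ (by positivity)] at h
    linarith
  · have h := antitoneOn_norm_deriv_sq_mul hf hinj hne he hmem0
      (show r ∈ Set.Ioo (-1 : ℝ) 1 from ⟨by linarith, hr⟩) hr0
    simp only [Complex.ofReal_zero, zero_mul, hf1, norm_one, sub_zero, add_zero, one_pow, div_one,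
      mul_one] at h
    refine le_of_sq_le_sq ?_ (by positivity)
    rw [div_pow, le_div_iff₀ (by positivity)]
    rw [← mul_div_assoc, div_le_iff₀ (by positivity)] at h
    linarith
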